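/- arXiv:1704.06055 — 7 statements merged into one kernel-verified Lean document; each statement's English description precedes it below -/
import Mathlib

section
/- Let a, b ∈ ℤ with a < 0 and b ≥ 1, and set q = ⌊−a/b⌋ + 1 and a′ = a + q·b. Then 1 ≤ a′ ≤ b, and as maps ℕ₀ → ℕ₀ one has f_{a′} = f_b^{∘q} ∘ f_a, i.e., for every x ∈ ℕ₀, applying f_a and then f_b exactly q times yields |x − a′|. -/
noncomputable section

/-- For `y : ℤ`, the reflection map `f_y : ℕ₀ → ℕ₀`, `f_y(x) = |x - y|`. -/
def reflMap (y : ℤ) : ℕ → ℕ := fun x => ((x : ℤ) - y).natAbs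

theorem reflMap_of_le {y : ℤ} {x : ℕ} (h : y ≤ x) : (reflMap y x : ℤ) = x - y := by
  unfold reflMap
  omega

/-- As long as the values stay nonnegative, iterating `f_b` just subtracts `b` each time. -/
theorem iterate_reflMap_of_mul_le {b : ℤ} (hb : 0 ≤ b) (k n : ℕ) (h : k * b ≤ n) :
    (((reflMap b)^[k] n : ℕ) : ℤ) = n - k * b := by
  induction k with
  | zero => simp
  | succ k ih =>
    push_cast [add_mul] at h ⊢
    have hk := ih (by linarith)
    rw [Function.iterate_succ_apply', reflMap_of_le (by linarith), hk]
    ring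

/-- Let `a, b ∈ ℤ` with `a < 0` and `b ≥ 1`, and set
`q = ⌊-a/b⌋ + 1` and `a' = a + q·b`. Then `1 ≤ a' ≤ b`, and as maps `ℕ₀ → ℕ₀`
one has `f_{a'} = f_b^{∘q} ∘ f_a`: for every `x ∈ ℕ₀`, applying `f_a` and then
`f_b` exactly `q` times yields `|x - a'|`. -/
theorem stmt_2 (a b : ℤ) (ha : a < 0) (hb : 1 ≤ b) :
    1 ≤ a + ((-a) / b + 1) * b ∧
    a + ((-a) / b + 1) * b ≤ b ∧
    ∀ x : ℕ, (reflMap b)^[(((-a) / b + 1)).toNat] (reflMap a x)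
      = reflMap (a + ((-a) / b + 1) * b) x := by
  have hdiv := Int.mul_ediv_add_emod (-a) b
  have hr0 := Int.emod_nonneg (-a) (show b ≠ 0 by omega)
  have hrb := Int.emod_lt_of_pos (-a) (show 0 < b by omega)
  have hq : 0 ≤ -a / b := Int.ediv_nonneg (by omega) (by omega)
  obtain ⟨k, hk⟩ := Int.eq_ofNat_of_zero_le hq
  rw [hk] at hdiv ⊢
  refine ⟨by linarith, by linarith, fun x => ?_⟩
  have hfa : (reflMap a x : ℤ) = x - a := reflMap_of_le (by omega)
  have hiter := iterate_reflMap_of_mul_le (show 0 ≤ b by omega) k (reflMap a x) (by linarith)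
  rw [show ((k : ℤ) + 1).toNat = k + 1 by omega, Function.iterate_succ_apply']
  unfold reflMap at hfa hiter ⊢
  rw [hiter, hfa]
  congr 1
  ring

end
end

section
/- Let 0 < y₀ < y₁ < ⋯ < y_m be integers and set d_k = gcd(y₀, …, y_k) for 0 ≤ k ≤ m. Then for each k ∈ {0, …, m} there exists a map g : ℕ₀ → ℕ₀ which is a finite nonempty composition of maps from {f_{y₀}, …, f_{y_k}} such that g(n) = |n − d_k| for all n ∈ {0, 1, …, d_k}. -/
noncomputable section

/-- Some map in `S` sends `|z * d + t|` to `|w * d + t|` for all `0 ≤ t ≤ d`. Thus an integer `z`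
stands for a directed segment of length `d` in `ℕ`: the ascending one starting at `z * d`
if `0 ≤ z`, and the descending one starting at `-z * d` if `z < 0`. -/
def SegmentReaches (S : Set (ℕ → ℕ)) (d z w : ℤ) : Prop :=
  ∃ g ∈ S, ∀ t : ℤ, 0 ≤ t → t ≤ d → g (z * d + t).natAbs = (w * d + t).natAbs

theorem SegmentReaches.refl {S : Set (ℕ → ℕ)} (hid : id ∈ S) (d z : ℤ) :
    SegmentReaches S d z z :=
  ⟨id, hid, fun _ _ _ => rfl⟩

theorem SegmentReaches.trans {S : Set (ℕ → ℕ)} (hcomp : ∀ g ∈ S, ∀ h ∈ S, g ∘ h ∈ S)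
    {d u v w : ℤ} (huv : SegmentReaches S d u v) (hvw : SegmentReaches S d v w) :
    SegmentReaches S d u w := by
  obtain ⟨g, hg, hgt⟩ := huv
  obtain ⟨h, hh, hht⟩ := hvw
  refine ⟨h ∘ g, hcomp h hh g hg, fun t h0 h1 => ?_⟩
  rw [Function.comp_apply, hgt t h0 h1, hht t h0 h1]

theorem SegmentReaches.mono {S T : Set (ℕ → ℕ)} (hST : S ⊆ T) {d z w : ℤ}
    (h : SegmentReaches S d z w) : SegmentReaches T d z w := by
  obtain ⟨g, hg, hgt⟩ := h
  exact ⟨g, hST hg, hgt⟩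

theorem segmentReaches_sub_of_nonneg {S : Set (ℕ → ℕ)} {d p z : ℤ}
    (hf : reflMap (p * d) ∈ S) (hz : 0 ≤ z) : SegmentReaches S d z (z - p) := by
  refine ⟨_, hf, fun t h0 h1 => ?_⟩
  have : 0 ≤ z * d := mul_nonneg hz (h0.trans h1)
  rw [reflMap, Int.natAbs_of_nonneg (by linarith)]
  congr 1
  ring

theorem segmentReaches_add_of_neg {S : Set (ℕ → ℕ)} {d p z : ℤ}
    (hf : reflMap (p * d) ∈ S) (hz : z < 0) : SegmentReaches S d z (z + p) := by
  refine ⟨_, hf, fun t h0 h1 => ?_⟩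
  have : z * d + t ≤ 0 := by nlinarith
  rw [reflMap, Int.ofNat_natAbs_of_nonpos this, ← Int.natAbs_neg]
  congr 1
  ring

/-- Every segment of length `d` can be carried onto `[0, d]`, in both directions. -/
def Folds (S : Set (ℕ → ℕ)) (d : ℤ) : Prop :=
  ∀ z : ℤ, SegmentReaches S d z 0 ∧ SegmentReaches S d z (-1)

theorem folds_of_reflMap_mem {S : Set (ℕ → ℕ)} (hid : id ∈ S)
    (hcomp : ∀ g ∈ S, ∀ h ∈ S, g ∘ h ∈ S) {d : ℤ} (hf : reflMap d ∈ S) : Folds S d := by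
  have hf' : reflMap (1 * d) ∈ S := by rwa [one_mul]
  have pos : ∀ n : ℕ, SegmentReaches S d n 0 := by
    intro n
    induction n with
    | zero => exact .refl hid d 0
    | succ n ih =>
      refine .trans hcomp (segmentReaches_sub_of_nonneg hf' (by positivity)) ?_
      simpa using ih
  have neg : ∀ n : ℕ, SegmentReaches S d (-1 - n) (-1) := by
    intro n
    induction n with
    | zero => simpa using SegmentReaches.refl hid d (-1)
    | succ n ih =>
      refine .trans hcomp (segmentReaches_add_of_neg hf' (by push_cast; linarith)) ?_
      convert ih using 1
      push_cast
      ring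
  have down : SegmentReaches S d 0 (-1) := segmentReaches_sub_of_nonneg hf' le_rfl
  have up : SegmentReaches S d (-1) 0 := segmentReaches_add_of_neg hf' (by norm_num)
  intro z
  rcases le_or_gt 0 z with hz | hz
  · lift z to ℕ using hz
    exact ⟨pos z, (pos z).trans hcomp down⟩
  · obtain ⟨n, rfl⟩ : ∃ n : ℕ, z = -1 - n := ⟨(-1 - z).toNat, by omega⟩
    exact ⟨(neg n).trans hcomp up, neg n⟩

theorem Folds.segmentReaches_of_modEq {S : Set (ℕ → ℕ)} {d q z w : ℤ}
    (h : Folds S (q * d)) (hw : -q ≤ w) (hw' : w < q) (hzw : z ≡ w [ZMOD q]) :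
    SegmentReaches S d z w := by
  obtain ⟨c, hc⟩ := hzw.dvd
  have key : ∀ a b : ℤ, SegmentReaches S (q * d) a b → ∀ r : ℤ, 0 ≤ r → r < q →
      SegmentReaches S d (a * q + r) (b * q + r) := by
    rintro a b ⟨g, hg, hgt⟩ r hr hrq
    refine ⟨g, hg, fun t h0 h1 => ?_⟩
    have hrd : 0 ≤ r * d := mul_nonneg hr (h0.trans h1)
    have := hgt (r * d + t) (by linarith) (by nlinarith)
    rwa [← add_assoc, ← add_assoc, ← mul_assoc, ← mul_assoc, ← add_mul, ← add_mul] at this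
  rcases le_or_gt 0 w with h0 | h0
  · convert key (-c) 0 (h _).1 w h0 hw' using 1 <;> linarith
  · convert key (-c - 1) (-1) (h _).2 (w + q) (by linarith) (by linarith) using 1 <;> linarith

theorem Folds.of_coprime {S : Set (ℕ → ℕ)} (hcomp : ∀ g ∈ S, ∀ h ∈ S, g ∘ h ∈ S)
    {d p q : ℤ} (hq : 0 < q) (hpq : IsCoprime p q) (h : Folds S (q * d))
    (hf : reflMap (p * d) ∈ S) : Folds S d := by
  have shift : ∀ (n : ℕ) (z w : ℤ), -q ≤ w → w < q → z - n * p ≡ w [ZMOD q] →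
      SegmentReaches S d z w := by
    intro n
    induction n with
    | zero =>
      intro z w hw hw' hzw
      exact h.segmentReaches_of_modEq hw hw' (by simpa using hzw)
    | succ n ih =>
      intro z w hw hw' hzw
      have hr := Int.emod_nonneg z hq.ne'
      have hr' := Int.emod_lt_of_pos z hq
      refine .trans hcomp
        (h.segmentReaches_of_modEq (by linarith) hr' (Int.mod_modEq z q).symm) ?_
      refine .trans hcomp (segmentReaches_sub_of_nonneg hf hr) (ih _ w hw hw' ?_)
      refine .trans ?_ hzw
      convert (Int.mod_modEq z q).sub_right ((n + 1 : ℤ) * p) using 1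
      · ring
      · push_cast
        rfl
  have main : ∀ z w : ℤ, -q ≤ w → w < q → SegmentReaches S d z w := by
    intro z w hw hw'
    obtain ⟨a, b, hab⟩ := hpq
    set e := (z - w) * a with he
    refine shift (e % q).toNat z w hw hw' ?_
    rw [Int.toNat_of_nonneg (Int.emod_nonneg e hq.ne')]
    refine (((Int.mod_modEq e q).mul_right p).sub_left z).trans ?_
    refine (Int.modEq_iff_dvd.mpr ⟨-((z - w) * b), ?_⟩)
    rw [he]
    linear_combination (z - w) * hab
  exact fun z => ⟨main z 0 (by linarith) hq, main z (-1) (by linarith) (by linarith)⟩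

theorem Folds.gcd {S : Set (ℕ → ℕ)} (hcomp : ∀ g ∈ S, ∀ h ∈ S, g ∘ h ∈ S)
    {d y : ℤ} (hd : 0 < d) (h : Folds S d) (hf : reflMap y ∈ S) :
    Folds S (Int.gcd y d) := by
  have hpos : 0 < Int.gcd y d := Int.gcd_pos_of_ne_zero_right y hd.ne'
  obtain ⟨p, q, hpq, hp, hq⟩ := Int.exists_gcd_one hpos
  have hq0 : 0 < q := by
    by_contra! hle
    nlinarith
  refine Folds.of_coprime hcomp hq0 (Int.isCoprime_iff_gcd_eq_one.mpr hpq) ?_ ?_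
  · rwa [← hq]
  · rwa [← hp]

/-- The possibly empty compositions of the maps `f_{y₀}, …, f_{y_k}`. -/
def reflCompositions (y : ℕ → ℤ) (k : ℕ) : Set (ℕ → ℕ) :=
  {g | ∃ l : List ℕ, (∀ j ∈ l, j ≤ k) ∧ g = (l.map fun j => reflMap (y j)).foldr (· ∘ ·) id}

theorem id_mem_reflCompositions (y : ℕ → ℤ) (k : ℕ) : id ∈ reflCompositions y k :=
  ⟨[], by simp, rfl⟩

theorem reflMap_mem_reflCompositions (y : ℕ → ℤ) {i k : ℕ} (hi : i ≤ k) :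
    reflMap (y i) ∈ reflCompositions y k :=
  ⟨[i], by simpa using hi, rfl⟩

theorem comp_mem_reflCompositions (y : ℕ → ℤ) (k : ℕ) :
    ∀ g ∈ reflCompositions y k, ∀ h ∈ reflCompositions y k, g ∘ h ∈ reflCompositions y k := by
  rintro _ ⟨l, hl, rfl⟩ _ ⟨l', hl', rfl⟩
  refine ⟨l ++ l', fun j hj => (List.mem_append.mp hj).elim (hl j) (hl' j), ?_⟩
  clear hl
  induction l with
  | nil => rfl
  | cons a l ih =>
    simp only [List.map_cons, List.foldr_cons, List.cons_append, Function.comp_assoc, ih]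

theorem reflCompositions_mono (y : ℕ → ℤ) {i k : ℕ} (hik : i ≤ k) :
    reflCompositions y i ⊆ reflCompositions y k := by
  rintro _ ⟨l, hl, rfl⟩
  exact ⟨l, fun j hj => (hl j hj).trans hik, rfl⟩

theorem Finset.gcd_range_succ_pos {y : ℕ → ℤ} (hpos : 0 < y 0) (k : ℕ) :
    0 < Finset.gcd (Finset.range (k + 1)) y := by
  refine lt_of_le_of_ne (Int.nonneg_of_normalize_eq_self Finset.normalize_gcd) fun h => ?_
  exact hpos.ne' (Finset.gcd_eq_zero_iff.mp h.symm 0 (by simp))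

theorem folds_reflCompositions {y : ℕ → ℤ} (hpos : 0 < y 0) (k : ℕ) :
    Folds (reflCompositions y k) (Finset.gcd (Finset.range (k + 1)) y) := by
  induction k with
  | zero =>
    have : Finset.gcd (Finset.range (0 + 1)) y = y 0 := by
      simp [Int.normalize_of_nonneg hpos.le]
    rw [this]
    exact folds_of_reflMap_mem (id_mem_reflCompositions y 0) (comp_mem_reflCompositions y 0)
      (reflMap_mem_reflCompositions y le_rfl)
  | succ k ih =>
    rw [Finset.range_add_one, Finset.gcd_insert, ← Int.coe_gcd]
    refine Folds.gcd (comp_mem_reflCompositions y _) (Finset.gcd_range_succ_pos hpos k)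
      (fun z => ?_) (reflMap_mem_reflCompositions y le_rfl)
    exact ⟨(ih z).1.mono (reflCompositions_mono y k.le_succ),
      (ih z).2.mono (reflCompositions_mono y k.le_succ)⟩

/-- Let `0 < y₀ < y₁ < ⋯ < y_m` be integers and
`d_k = gcd(y₀, …, y_k)`. Then for each `k ≤ m` there is a map `g : ℕ₀ → ℕ₀`
which is a finite nonempty composition of maps from `{f_{y₀}, …, f_{y_k}}`
such that `g(n) = |n - d_k|` for all `n ∈ {0, 1, …, d_k}`. -/
theorem stmt_3 (m : ℕ) (y : ℕ → ℤ)
    (hpos : 0 < y 0) (hmono : ∀ i, i < m → y i < y (i + 1)) :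
    ∀ k, k ≤ m →
      ∃ g : ℕ → ℕ,
        (∃ l : List ℕ, l ≠ [] ∧ (∀ j ∈ l, j ≤ k) ∧
            g = (l.map fun j => reflMap (y j)).foldr (· ∘ ·) id) ∧
        ∀ n : ℕ, (n : ℤ) ≤ Finset.gcd (Finset.range (k + 1)) y →
          g n = ((n : ℤ) - Finset.gcd (Finset.range (k + 1)) y).natAbs := by
  intro k _
  have hd := Finset.gcd_range_succ_pos hpos k
  obtain ⟨_, ⟨l, hl, rfl⟩, hg⟩ := (folds_reflCompositions hpos k 0).2
  set d := Finset.gcd (Finset.range (k + 1)) y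
  refine ⟨_, ⟨l, ?_, hl, rfl⟩, fun n hn => ?_⟩
  · rintro rfl
    have := hg 0 le_rfl hd.le
    simp at this
    omega
  · have := hg n (by positivity) hn
    rw [zero_mul, zero_add, Int.natAbs_natCast] at this
    rw [this]
    congr 1
    ring

end
end

section
/- Let A ⊆ ℤ be a set with gcd(A) = 1 and A ∩ (0,∞) ≠ ∅. Then there exists a sequence (h_k) of maps ℕ₀ → ℕ₀, each of the form h_k = f_{a_m} ∘ ⋯ ∘ f_{a_1} with a₁, …, a_m ∈ A and a₁ + ⋯ + a_m even, such that h_k converges pointwise on ℕ₀ to the indicator function of the odd natural numbers: h_k(x) → 1 for every odd x and h_k(x) → 0 for every even x. (This expresses that the parity-indicator function lies in the closure of the semigroup generated by the support of the distribution of the induced parity-preserving random maps of the reflected random walk.) -/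
open Filter

noncomputable section

/-- The maps `ℕ → ℕ` that are nonempty compositions of reflections `f_a` with `a ∈ A`. -/
def IsReflWord (A : Set ℤ) (w : ℕ → ℕ) : Prop :=
  ∃ l : List ℤ, l ≠ [] ∧ (∀ a ∈ l, a ∈ A) ∧ w = (l.map reflMap).foldr (· ∘ ·) id

/-- On `[0, m]`, the reflection `f_c` agrees with a composition of reflections from `A`. -/
def ReflEffective (A : Set ℤ) (m : ℕ) (c : ℤ) : Prop :=
  ∃ w, IsReflWord A w ∧ ∀ x ≤ m, w x = reflMap c x

/-- Every bounded set of points can be moved into `[0, m]` by a composition of reflections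
from `A`. -/
def ReflCollapses (A : Set ℤ) (m : ℕ) : Prop :=
  ∀ N : ℕ, ∃ w, IsReflWord A w ∧ ∀ x ≤ N, w x ≤ m

lemma foldr_comp_append (l₁ l₂ : List (ℕ → ℕ)) :
    (l₁ ++ l₂).foldr (· ∘ ·) id = l₁.foldr (· ∘ ·) id ∘ l₂.foldr (· ∘ ·) id := by
  induction l₁ with
  | nil => rfl
  | cons f l ih => simp only [List.cons_append, List.foldr_cons, ih, Function.comp_assoc]

lemma IsReflWord.comp {A : Set ℤ} {v w : ℕ → ℕ} (hv : IsReflWord A v) (hw : IsReflWord A w) :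
    IsReflWord A (v ∘ w) := by
  obtain ⟨l₁, h₁, hA₁, rfl⟩ := hv
  obtain ⟨l₂, -, hA₂, rfl⟩ := hw
  refine ⟨l₁ ++ l₂, by simp [h₁], ?_, by rw [List.map_append, foldr_comp_append]⟩
  intro a ha
  rcases List.mem_append.1 ha with h | h
  exacts [hA₁ a h, hA₂ a h]

lemma isReflWord_reflMap {A : Set ℤ} {a : ℤ} (ha : a ∈ A) : IsReflWord A (reflMap a) :=
  ⟨[a], by simp, by simpa using ha, by simp⟩

lemma even_foldr_reflMap (l : List ℤ) (x : ℕ) :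
    Even ((((l.map reflMap).foldr (· ∘ ·) id x : ℕ) : ℤ) - x - l.sum) := by
  induction l with
  | nil => simp
  | cons a l ih =>
    simp only [List.map_cons, List.foldr_cons, List.sum_cons, Function.comp_apply]
    rw [Int.even_iff] at ih ⊢
    generalize (l.map reflMap).foldr (· ∘ ·) id x = y at *
    unfold reflMap
    omega

lemma ReflEffective.comp {A : Set ℤ} {n m : ℕ} {b c e : ℤ} (hc : ReflEffective A n c)
    (hb : ReflEffective A m b) (hle : ∀ x ≤ n, reflMap c x ≤ m)
    (heq : ∀ x ≤ n, reflMap b (reflMap c x) = reflMap e x) : ReflEffective A n e := by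
  obtain ⟨w, hw, hwx⟩ := hc
  obtain ⟨v, hv, hvx⟩ := hb
  refine ⟨v ∘ w, hv.comp hw, fun x hx => ?_⟩
  rw [Function.comp_apply, hwx x hx, hvx _ (hle x hx), heq x hx]

lemma ReflEffective.mono {A : Set ℤ} {n m : ℕ} {c : ℤ} (hc : ReflEffective A m c)
    (h : n ≤ m) : ReflEffective A n c :=
  let ⟨w, hw, hwx⟩ := hc
  ⟨w, hw, fun x hx => hwx x (hx.trans h)⟩

lemma reflEffective_of_mem {A : Set ℤ} {a : ℤ} (ha : a ∈ A) (m : ℕ) : ReflEffective A m a :=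
  ⟨_, isReflWord_reflMap ha, fun _ _ => rfl⟩

/-- Iterating `f_d` moves `[0, d + k]` into `[0, d]`. -/
lemma ReflEffective.exists_le {A : Set ℤ} {d : ℕ} (hd : 0 < d) (k : ℕ)
    (h : ReflEffective A (d + k) d) :
    ∃ w, IsReflWord A w ∧ ∀ x ≤ d + k, w x ≤ d := by
  induction k with
  | zero =>
    obtain ⟨w, hw, hwx⟩ := h
    refine ⟨w, hw, fun x hx => ?_⟩
    rw [hwx x hx, reflMap]
    omega
  | succ k ih =>
    obtain ⟨v, hv, hvx⟩ := ih (h.mono (by omega))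
    obtain ⟨w, hw, hwx⟩ := h
    refine ⟨v ∘ w, hv.comp hw, fun x hx => hvx _ ?_⟩
    rw [hwx x hx, reflMap]
    omega

lemma reflCollapses_of_mem {A : Set ℤ} {d : ℕ} (hd : 0 < d) (h : (d : ℤ) ∈ A) :
    ReflCollapses A d := fun N =>
  let ⟨w, hw, hwx⟩ := ReflEffective.exists_le hd N (reflEffective_of_mem h _)
  ⟨w, hw, fun x hx => hwx x (by omega)⟩

lemma ReflCollapses.of_reflEffective {A : Set ℤ} {m d : ℕ} (hm : ReflCollapses A m)
    (hd : 0 < d) (hdm : d ≤ m) (h : ReflEffective A m d) : ReflCollapses A d := by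
  intro N
  obtain ⟨k, rfl⟩ := Nat.exists_eq_add_of_le hdm
  obtain ⟨v, hv, hvx⟩ := h.exists_le hd k
  obtain ⟨w, hw, hwx⟩ := hm N
  exact ⟨v ∘ w, hv.comp hw, fun x hx => hvx _ (hwx x hx)⟩

/-- If `d` is effective on `[0, m]`, then effective reflections at points of `[0, m]` can be
reduced modulo `d`. -/
lemma ReflEffective.mod {A : Set ℤ} {m d : ℕ} (hd : 0 < d)
    (h : ReflEffective A m d) (c : ℕ) (hcm : c ≤ m) (hc : ReflEffective A d c) :
    ReflEffective A d ((c % d : ℕ) : ℤ) := by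
  induction c using Nat.strong_induction_on with
  | _ c ih =>
    rcases lt_or_ge c d with hlt | hge
    · rwa [Nat.mod_eq_of_lt hlt]
    · rw [Nat.mod_eq_sub_mod hge]
      refine ih (c - d) (by omega) (by omega) (hc.comp h ?_ ?_)
      all_goals
        intro x hx
        simp only [reflMap]
        omega

lemma reflEffective_natCast_mod_of_mem {A : Set ℤ} {d : ℕ} (hd : 0 < d) (hA : (d : ℤ) ∈ A)
    (c : ℕ) (hc : ReflEffective A d c) : ReflEffective A d ((c % d : ℕ) : ℤ) :=
  ReflEffective.mod (m := d + c) hd (reflEffective_of_mem hA _) c (by omega) hc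

/-- For `c ≤ 0`, composing with `f_d` shifts the centre `c` to `c + d`. -/
lemma exists_reflEffective_modEq_of_neg {A : Set ℤ} {d : ℕ} (hd : 0 < d) (hA : (d : ℤ) ∈ A)
    (n : ℕ) (hc : ReflEffective A d (-(n : ℤ))) :
    ∃ b : ℕ, ReflEffective A d b ∧ b ≤ d ∧ (d : ℤ) ∣ -(n : ℤ) - b := by
  induction n using Nat.strong_induction_on with
  | _ n ih =>
    have key : ReflEffective A d (-(n : ℤ) + d) := by
      refine hc.comp (reflEffective_of_mem hA (d + n)) ?_ ?_
      all_goals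
        intro x hx
        simp only [reflMap]
        omega
    rcases le_or_gt n d with hle | hgt
    · refine ⟨d - n, ?_, by omega, ⟨-1, by push_cast [hle]; ring⟩⟩
      convert key using 1
      omega
    · obtain ⟨b, hb, hbd, k, hk⟩ := ih (n - d) (by omega) (by convert key using 1; omega)
      refine ⟨b, hb, hbd, k - 1, ?_⟩
      rw [mul_sub, ← hk]
      push_cast [hgt.le]
      ring

lemma exists_reflEffective_modEq {A : Set ℤ} {d : ℕ} (hd : 0 < d) (hA : (d : ℤ) ∈ A)
    {a : ℤ} (ha : a ∈ A) :
    ∃ b : ℕ, ReflEffective A d b ∧ b ≤ d ∧ (d : ℤ) ∣ a - b := by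
  have h := reflEffective_of_mem ha d
  obtain ⟨n, rfl | rfl⟩ := a.eq_nat_or_neg
  · refine ⟨n % d, reflEffective_natCast_mod_of_mem hd hA n h, (Nat.mod_lt _ hd).le, ?_⟩
    push_cast
    exact Int.dvd_self_sub_emod
  · exact exists_reflEffective_modEq_of_neg hd hA n h

/-- A Euclidean descent: if the centres effective on `[0, m]` have no common divisor, then every
bounded set can be moved into `{0, 1}`, where `f_1` is effective. -/
lemma reflCollapses_one {A : Set ℤ} (m : ℕ) (hm : 0 < m) (hcol : ReflCollapses A m)
    (heff : ReflEffective A m m)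
    (hgcd : ∀ g : ℕ, (∀ c : ℕ, c ≤ m → ReflEffective A m c → g ∣ c) → g = 1) :
    ReflCollapses A 1 ∧ ReflEffective A 1 (1 : ℕ) := by
  induction m using Nat.strong_induction_on with
  | _ m ih =>
    by_cases hex : ∃ d : ℕ, 0 < d ∧ d < m ∧ ReflEffective A m d
    · obtain ⟨d, hd, hdm, h⟩ := hex
      refine ih d hdm hd (hcol.of_reflEffective hd hdm.le h) (h.mono hdm.le) fun g hg => ?_
      refine hgcd g fun c hcm hc => ?_
      have hmod := ReflEffective.mod hd h c hcm (hc.mono hdm.le)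
      exact (Nat.dvd_mod_iff (hg d le_rfl (h.mono hdm.le))).1
        (hg _ (Nat.mod_lt _ hd).le hmod)
    · push Not at hex
      obtain rfl : m = 1 := hgcd m fun c hcm hc => by
        rcases Nat.eq_zero_or_pos c with rfl | hpos
        · exact dvd_zero m
        · rcases hcm.eq_or_lt with rfl | hlt
          · exact dvd_rfl
          · exact absurd hc (hex c hpos hlt)
      exact ⟨hcol, heff⟩

lemma exists_even_word_eq_parity {A : Set ℤ} (hcol : ReflCollapses A 1)
    (heff : ReflEffective A 1 (1 : ℕ)) (N : ℕ) :
    ∃ w : ℕ → ℕ, (∃ l : List ℤ, l ≠ [] ∧ (∀ a ∈ l, a ∈ A) ∧ Even l.sum ∧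
        w = (l.map reflMap).foldr (· ∘ ·) id) ∧
      ∀ x ≤ N, w x = if Odd x then 1 else 0 := by
  have key : ∃ l : List ℤ, l ≠ [] ∧ (∀ a ∈ l, a ∈ A) ∧ Even l.sum ∧
      ∀ x ≤ N, (l.map reflMap).foldr (· ∘ ·) id x ≤ 1 := by
    obtain ⟨w, ⟨l, hl, hlA, rfl⟩, hw⟩ := hcol N
    by_cases hs : Even l.sum
    · exact ⟨l, hl, hlA, hs, hw⟩
    · obtain ⟨v, ⟨l', hl', hlA', rfl⟩, hv⟩ := heff
      have hodd := even_foldr_reflMap l' 0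
      rw [hv 0 (by omega)] at hodd
      refine ⟨l' ++ l, by simp [hl], ?_, ?_, ?_⟩
      · intro a ha
        rcases List.mem_append.1 ha with h | h
        exacts [hlA' a h, hlA a h]
      · rw [List.sum_append]
        simp only [reflMap, Int.even_iff] at *
        omega
      · intro x hx
        rw [List.map_append, foldr_comp_append, Function.comp_apply, hv _ (hw x hx)]
        have := hw x hx
        simp only [reflMap]
        omega
  obtain ⟨l, hl, hlA, hs, hle⟩ := key
  refine ⟨_, ⟨l, hl, hlA, hs, rfl⟩, fun x hx => ?_⟩
  have h := even_foldr_reflMap l x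
  have h1 := hle x hx
  rw [Int.even_iff] at h hs
  split_ifs with ho <;> rw [Nat.odd_iff] at ho <;> omega

/-- Let `A ⊆ ℤ` with `gcd A = 1` and `A ∩ (0,∞) ≠ ∅`. Then
there is a sequence `(h_k)` of maps `ℕ₀ → ℕ₀`, each a finite nonempty
composition `f_{a_m} ∘ ⋯ ∘ f_{a_1}` with `a₁, …, a_m ∈ A` of even total sum,
converging pointwise to the indicator function of the odd natural numbers. -/
theorem stmt_5 (A : Set ℤ)
    (hgcd : ∀ d : ℤ, (∀ a ∈ A, d ∣ a) → IsUnit d)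
    (hpos : (A ∩ Set.Ioi (0 : ℤ)).Nonempty) :
    ∃ h : ℕ → (ℕ → ℕ),
      (∀ k : ℕ, ∃ l : List ℤ, l ≠ [] ∧ (∀ a ∈ l, a ∈ A) ∧ Even l.sum ∧
        h k = (l.map reflMap).foldr (· ∘ ·) id) ∧
      (∀ x : ℕ, ∀ᶠ k in atTop, h k x = if Odd x then 1 else 0) := by
  obtain ⟨a, haA, ha⟩ := hpos
  lift a to ℕ using (le_of_lt ha)
  have hm : 0 < a := by simpa using ha
  obtain ⟨hcol, heff⟩ := reflCollapses_one a hm (reflCollapses_of_mem hm haA)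
    (reflEffective_of_mem haA a) fun g hg => by
      refine Int.ofNat_isUnit.1 (hgcd g fun b hb => ?_) |> Nat.isUnit_iff.1
      obtain ⟨c, hc, hca, hdvd⟩ := exists_reflEffective_modEq hm haA hb
      have hga : (g : ℤ) ∣ a := Int.natCast_dvd_natCast.2
        (hg a le_rfl (reflEffective_of_mem haA a))
      have hgc : (g : ℤ) ∣ c := Int.natCast_dvd_natCast.2 (hg c hca hc)
      exact (dvd_sub_left hgc).1 (hga.trans hdvd)
  choose h hword hval using exists_even_word_eq_parity hcol heff
  exact ⟨h, hword, fun x => (eventually_ge_atTop x).mono fun k hk => hval k x hk⟩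

end
end

section
/- Let μ be a non-lattice probability measure on ℝ with supp(μ) ⊆ [0,∞). Define the measure ν on [0,∞) by ν(dx) = μ((x,∞)) dx, i.e., ν has density x ↦ μ((x,∞)) with respect to Lebesgue measure. Then ν is an invariant measure for the reflected random walk: for every Borel set B ⊆ [0,∞), ∫_{[0,∞)} μ({y ∈ ℝ : |x − y| ∈ B}) dν(x) = ν(B). -/
open MeasureTheory Set
open scoped ENNReal

noncomputable section

/-- The topological support of a measure. -/
def msupp {α : Type*} [TopologicalSpace α] [MeasurableSpace α] (μ : Measure α) : Set α :=
  {x | ∀ U ∈ nhds x, μ U ≠ 0}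

/-- `μ` is a lattice distribution if `supp(μ) ⊆ κ·ℤ` for some `κ > 0`. -/
def IsLatticeDist (μ : Measure ℝ) : Prop :=
  ∃ κ : ℝ, 0 < κ ∧ msupp μ ⊆ {x : ℝ | ∃ k : ℤ, x = κ * k}

/-- The measure `ν(dx) = μ((x,∞)) dx` on `[0,∞)`. -/
def fellerMeasure (μ : Measure ℝ) : Measure ℝ :=
  (volume.restrict (Ici (0 : ℝ))).withDensity fun x => μ (Ioi x)

/-- A measure on `ℝ` supported in `[0,∞)` gives no mass to the negative half-line. -/
theorem ae_nonneg_of_msupp_subset {μ : Measure ℝ} (hsupp : msupp μ ⊆ Ici 0) :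
    ∀ᵐ x ∂μ, 0 ≤ x := by
  have h : μ (Iio 0) = 0 := by
    refine measure_null_of_locally_null _ fun x hx => ?_
    have hx' : x ∉ msupp μ := fun h => (mem_Iio.mp hx).not_ge (mem_Ici.mp (hsupp h))
    simp only [msupp, mem_ofPred_eq, not_forall, not_not] at hx'
    obtain ⟨U, hU, hU0⟩ := hx'
    exact ⟨U, mem_nhdsWithin_of_mem_nhds hU, hU0⟩
  rw [ae_iff]
  simpa [Iio] using h

/-- Integration against `fellerMeasure μ` is averaging over `z ∼ μ` of integrals over `[0,z)`. -/
theorem lintegral_fellerMeasure (μ : Measure ℝ) [SFinite μ] {g : ℝ → ℝ≥0∞} (hg : Measurable g) :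
    ∫⁻ x, g x ∂(fellerMeasure μ) = ∫⁻ z, (∫⁻ x in Ico 0 z, g x) ∂μ := by
  have hm : Measurable fun x : ℝ => μ (Ioi x) :=
    Antitone.measurable fun _ _ hab => measure_mono (Ioi_subset_Ioi hab)
  have hlt : MeasurableSet {p : ℝ × ℝ | p.1 < p.2} := measurableSet_lt measurable_fst measurable_snd
  have hmeas : Measurable (Function.uncurry fun x z : ℝ => (Ioi x).indicator (fun _ => g x) z) :=
    (hg.comp measurable_fst).indicator hlt
  calc ∫⁻ x, g x ∂(fellerMeasure μ)
      = ∫⁻ x in Ici 0, μ (Ioi x) * g x := lintegral_withDensity_eq_lintegral_mul _ hm hg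
    _ = ∫⁻ x in Ici 0, ∫⁻ z, (Ioi x).indicator (fun _ => g x) z ∂μ := by
        refine lintegral_congr fun x => ?_
        rw [lintegral_indicator_const measurableSet_Ioi, mul_comm]
    _ = ∫⁻ z, (∫⁻ x in Ici 0, (Ioi x).indicator (fun _ => g x) z) ∂μ :=
        lintegral_lintegral_swap hmeas.aemeasurable
    _ = ∫⁻ z, (∫⁻ x in Ico 0 z, g x) ∂μ := by
        refine lintegral_congr fun z => ?_
        have h : ∀ x, (Ioi x).indicator (fun _ => g x) z = (Iio z).indicator g x := fun x => by
          simp [indicator]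
        simp_rw [h]
        rw [lintegral_indicator measurableSet_Iio, Measure.restrict_restrict measurableSet_Iio,
          inter_comm, Ici_inter_Iio]

/-- The Lebesgue measure of a trace on `[0,z)`, as an interval integral of an indicator. -/
theorem volume_Ico_inter_eq_ofReal {S : Set ℝ} (hS : MeasurableSet S) {z : ℝ} (hz : 0 ≤ z) :
    volume (Ico 0 z ∩ S) = ENNReal.ofReal (∫ x in (0 : ℝ)..z, S.indicator (fun _ => (1 : ℝ)) x) := by
  rw [intervalIntegral.integral_of_le hz, integral_indicator hS, setIntegral_const,
    smul_eq_mul, mul_one, Measure.real, ENNReal.ofReal_toReal (measure_ne_top _ _),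
    Measure.restrict_apply hS, inter_comm]
  exact measure_congr ((Filter.EventuallyEq.refl _ S).inter Ico_ae_eq_Ioc)

/-- Symmetrised overlap identity: for `y, z ≥ 0`, the sets `{x ∈ [0,z) : |x - y| ∈ B}` and
`{x ∈ [0,y) : |x - z| ∈ B}` have together the measure of `B ∩ [0,z)` plus that of `B ∩ [0,y)`. -/
theorem volume_abs_sub_mem_add {B : Set ℝ} (hB : MeasurableSet B) {y z : ℝ} (hy : 0 ≤ y)
    (hz : 0 ≤ z) :
    volume (Ico 0 z ∩ {x | |x - y| ∈ B}) + volume (Ico 0 y ∩ {x | |x - z| ∈ B}) =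
      volume (Ico 0 z ∩ B) + volume (Ico 0 y ∩ B) := by
  set f : ℝ → ℝ := fun s => B.indicator (fun _ => (1 : ℝ)) |s| with hf
  have hfm : Measurable f := (measurable_const.indicator hB).comp (by fun_prop)
  have hf0 : ∀ s, 0 ≤ f s := fun s => indicator_nonneg (fun _ _ => zero_le_one) _
  have hf1 : ∀ s, ‖f s‖ ≤ 1 := fun s => by
    rw [Real.norm_of_nonneg (hf0 s)]
    exact indicator_le_self' (fun _ _ => zero_le_one) _
  have hint : ∀ a b, IntervalIntegrable f volume a b := fun a b =>
    (intervalIntegrable_const (c := (1 : ℝ))).mono_fun hfm.aestronglyMeasurable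
      (ae_of_all _ fun s => by simpa using hf1 s)
  have habs : ∀ a b : ℝ, 0 ≤ b → volume (Ico 0 b ∩ {x | |x - a| ∈ B}) =
      ENNReal.ofReal (∫ x in (0 : ℝ)..b, f (x - a)) := fun a b hb =>
    volume_Ico_inter_eq_ofReal
      ((by fun_prop : Measurable fun x : ℝ => |x - a|) hB) hb
  have hself : ∀ b : ℝ, 0 ≤ b → volume (Ico 0 b ∩ B) =
      ENNReal.ofReal (∫ x in (0 : ℝ)..b, f x) := fun b hb => by
    have h : Ico 0 b ∩ B = Ico 0 b ∩ {x | |x - 0| ∈ B} := by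
      ext x
      simp only [mem_inter_iff, mem_Ico, mem_ofPred_eq, sub_zero]
      refine and_congr_right fun hx => ?_
      rw [abs_of_nonneg hx.1]
    rw [h, habs 0 b hb]
    simp
  have hnn : ∀ (a b : ℝ), 0 ≤ b → 0 ≤ ∫ x in (0 : ℝ)..b, f (x - a) := fun a b hb =>
    intervalIntegral.integral_nonneg hb fun _ _ => hf0 _
  have hnn' : ∀ b : ℝ, 0 ≤ b → 0 ≤ ∫ x in (0 : ℝ)..b, f x := fun b hb =>
    intervalIntegral.integral_nonneg hb fun _ _ => hf0 _
  have hodd : ∀ b, ∫ x in (-b)..0, f x = ∫ x in (0 : ℝ)..b, f x := fun b => by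
    have h := intervalIntegral.integral_comp_neg (a := 0) (b := b) f
    simp only [neg_zero] at h
    rw [← h]
    simp [hf]
  have hshift : ∀ a b, ∫ x in (0 : ℝ)..b, f (x - a) =
      (∫ x in (0 : ℝ)..a, f x) + ∫ x in (0 : ℝ)..(b - a), f x := fun a b => by
    rw [intervalIntegral.integral_comp_sub_right, zero_sub, ← hodd a,
      intervalIntegral.integral_add_adjacent_intervals (hint _ _) (hint _ _)]
  have hanti : (∫ x in (0 : ℝ)..(z - y), f x) = -∫ x in (0 : ℝ)..(y - z), f x := by
    rw [← hodd, neg_sub, intervalIntegral.integral_symm]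
  rw [habs y z hz, habs z y hy, hself z hz, hself y hy, ← ENNReal.ofReal_add (hnn _ _ hz) (hnn _ _ hy),
    ← ENNReal.ofReal_add (hnn' _ hz) (hnn' _ hy), hshift, hshift, hanti]
  congr 1
  ring

/-- Let `μ` be a non-lattice probability measure on `ℝ` with
`supp(μ) ⊆ [0,∞)`. Then the measure `ν(dx) = μ((x,∞)) dx` on `[0,∞)` is
invariant for the reflected random walk: for every Borel `B ⊆ [0,∞)`,
`∫ μ{y : |x - y| ∈ B} dν(x) = ν(B)`. -/
theorem stmt_7 (μ : Measure ℝ) [IsProbabilityMeasure μ]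
    (hsupp : msupp μ ⊆ Ici 0) (hnl : ¬ IsLatticeDist μ)
    (B : Set ℝ) (hB : MeasurableSet B) (hB0 : B ⊆ Ici 0) :
    ∫⁻ x, μ {y : ℝ | |x - y| ∈ B} ∂(fellerMeasure μ) = fellerMeasure μ B := by
  set G : ℝ → ℝ → ℝ≥0∞ := fun y z => volume (Ico 0 z ∩ {x | |x - y| ∈ B})
  set F : ℝ → ℝ≥0∞ := fun z => volume (Ico 0 z ∩ B)
  have hnn := ae_nonneg_of_msupp_subset hsupp
  have hS : MeasurableSet {p : ℝ × ℝ | |p.1 - p.2| ∈ B} :=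
    (by fun_prop : Measurable fun p : ℝ × ℝ => |p.1 - p.2|) hB
  have hFm : Measurable F :=
    Monotone.measurable fun _ _ hab =>
      measure_mono (inter_subset_inter_left _ (Ico_subset_Ico_right hab))
  have hGm : Measurable (Function.uncurry G) := by
    have hT : MeasurableSet {p : (ℝ × ℝ) × ℝ | (0 ≤ p.2 ∧ p.2 < p.1.2) ∧ |p.2 - p.1.1| ∈ B} :=
      ((measurableSet_le measurable_const measurable_snd).inter
        (measurableSet_lt measurable_snd (by fun_prop))).inter
        ((by fun_prop : Measurable fun p : (ℝ × ℝ) × ℝ => |p.2 - p.1.1|) hB)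
    exact measurable_measure_prodMk_left (ν := volume) hT
  have hGm' : Measurable (Function.uncurry fun z y => G y z) := hGm.comp measurable_swap
  have hleft : ∫⁻ x, μ {y : ℝ | |x - y| ∈ B} ∂(fellerMeasure μ) = ∫⁻ z, ∫⁻ y, G y z ∂μ ∂μ := by
    refine (lintegral_fellerMeasure μ (measurable_measure_prodMk_left (ν := μ) hS)).trans
      (lintegral_congr fun z => ?_)
    have h1 := Measure.prod_apply (μ := volume.restrict (Ico 0 z)) (ν := μ) hS
    have h2 := Measure.prod_apply_symm (μ := volume.restrict (Ico 0 z)) (ν := μ) hS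
    refine (h1.symm.trans h2).trans (lintegral_congr fun y => ?_)
    rw [Measure.restrict_apply (measurable_prodMk_right hS), inter_comm]
    rfl
  have hright : fellerMeasure μ B = ∫⁻ z, F z ∂μ := by
    rw [← lintegral_indicator_one hB, lintegral_fellerMeasure μ (measurable_one.indicator hB)]
    refine lintegral_congr fun z => ?_
    rw [lintegral_indicator_one hB, Measure.restrict_apply hB, inter_comm]
  have hswap : ∫⁻ z, ∫⁻ y, G z y ∂μ ∂μ = ∫⁻ z, ∫⁻ y, G y z ∂μ ∂μ :=
    lintegral_lintegral_swap hGm.aemeasurable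
  have hsum : ∫⁻ z, ∫⁻ y, (G y z + G z y) ∂μ ∂μ = ∫⁻ z, ∫⁻ y, (F z + F y) ∂μ ∂μ := by
    refine lintegral_congr_ae (hnn.mono fun z hz => lintegral_congr_ae (hnn.mono fun y hy => ?_))
    exact volume_abs_sub_mem_add hB hy hz
  have hsumG : ∫⁻ z, ∫⁻ y, (G y z + G z y) ∂μ ∂μ = 2 * ∫⁻ z, ∫⁻ y, G y z ∂μ ∂μ := by
    have h : ∀ z, ∫⁻ y, (G y z + G z y) ∂μ = ∫⁻ y, G y z ∂μ + ∫⁻ y, G z y ∂μ := fun z =>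
      lintegral_add_left (hGm.comp (measurable_prodMk_right (y := z))) _
    simp_rw [h]
    rw [lintegral_add_left hGm'.lintegral_prod_right, hswap, two_mul]
  have hsumF : ∫⁻ z, ∫⁻ y, (F z + F y) ∂μ ∂μ = 2 * ∫⁻ z, F z ∂μ := by
    have h : ∀ z, ∫⁻ y, (F z + F y) ∂μ = F z + ∫⁻ y, F y ∂μ := fun z => by
      rw [lintegral_add_left measurable_const, lintegral_const, measure_univ, mul_one]
    simp_rw [h]
    rw [lintegral_add_left hFm, lintegral_const, measure_univ, mul_one, two_mul]
  rw [hleft, hright]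
  exact (ENNReal.mul_right_inj two_ne_zero ENNReal.ofNat_ne_top).mp
    (hsumG.symm.trans (hsum.trans hsumF))

end
end

section
/- Let μ be a probability measure on ℤ with supp(μ) ⊆ ℕ₀. Define ν on ℕ₀ by ν(0) = (1 − μ({0}))/2 and ν(x) = μ({x})/2 + μ((x,∞)) for x ∈ ℕ = {1, 2, …}. Then ν is an invariant measure for the reflected random walk on ℕ₀: for every y ∈ ℕ₀, ∑_{x ∈ ℕ₀} ν(x) · μ({w ∈ ℤ : |x − w| = y}) = ν(y). -/
open MeasureTheory Set
open scoped ENNReal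

noncomputable section

/-- The support of a measure on `ℤ`. -/
def msuppZ (μ : Measure ℤ) : Set ℤ := {k | μ {k} ≠ 0}

/-- The Boudiba measure `ν` on `ℕ₀`: `ν(0) = (1 - μ{0})/2` and
`ν(x) = μ{x}/2 + μ((x,∞))` for `x ≥ 1`. -/
def boudibaMeasure (μ : Measure ℤ) : ℕ → ℝ≥0∞ := fun x =>
  if x = 0 then (1 - μ {0}) / 2 else μ {(x : ℤ)} / 2 + μ (Ioi (x : ℤ))

/-- Telescoping of a difference at distance `m`. -/
theorem sum_range_sub_shift (C : ℤ → ℝ) (m N : ℕ) :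
    ∑ x ∈ Finset.range N, (C ((x : ℤ) - m) - C x)
      = ∑ j ∈ Finset.range m, C ((j : ℤ) - m)
        - ∑ j ∈ Finset.range m, C ((N : ℤ) + j - m) := by
  induction N with
  | zero => simp
  | succ N ih =>
    have h := Finset.sum_range_sub' (fun j : ℕ => C ((N : ℤ) + j - m)) m
    rw [Finset.sum_sub_distrib] at h
    have h' : ∀ j : ℕ, ((N + 1 : ℕ) : ℤ) + j - m = (N : ℤ) + ((j + 1 : ℕ) : ℤ) - m := by
      intro j; push_cast; ring
    simp only [Finset.sum_range_succ, ih, h']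
    simp only [Nat.cast_zero, add_zero, add_sub_cancel_right] at h
    linarith

theorem hasSum_tail_mul_sub_tail {G : ℤ → ℝ} (hanti : Antitone G)
    (hlim : Filter.Tendsto G Filter.atTop (nhds 0)) (hneg : ∀ k < 0, G k = 1) (m : ℕ) :
    HasSum (fun x : ℕ => G x * (G ((x : ℤ) - m) - G ((x : ℤ) + m)))
      (∑ j ∈ Finset.range m, G j) := by
  have hnonneg : ∀ k, 0 ≤ G k := fun k => hanti.le_of_tendsto hlim k
  rw [hasSum_iff_tendsto_nat_of_nonneg
    fun x => mul_nonneg (hnonneg _) (sub_nonneg.2 (hanti (by omega)))]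
  have hpartial : ∀ N : ℕ,
      ∑ x ∈ Finset.range N, G x * (G ((x : ℤ) - m) - G ((x : ℤ) + m))
        = ∑ j ∈ Finset.range m, G j
          - ∑ j ∈ Finset.range m, G ((N : ℤ) + j - m) * G ((N : ℤ) + j) := by
    intro N
    have h := sum_range_sub_shift (fun i => G i * G (i + m)) m N
    simp only [sub_add_cancel] at h
    rw [Finset.sum_congr rfl fun j hj => ?_, h]
    · congr 1
      refine Finset.sum_congr rfl fun j hj => ?_
      rw [hneg _ (by have := Finset.mem_range.1 hj; omega), one_mul]
    · ring
  simp only [hpartial]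
  have hshift : ∀ c : ℤ, Filter.Tendsto (fun N : ℕ => G ((N : ℤ) + c)) Filter.atTop (nhds 0) :=
    fun c => hlim.comp
      (Filter.tendsto_atTop_add_const_right _ c tendsto_natCast_atTop_atTop)
  have h0 : Filter.Tendsto
      (fun N : ℕ => ∑ j ∈ Finset.range m, G ((N : ℤ) + j - m) * G ((N : ℤ) + j))
      Filter.atTop (nhds 0) := by
    have := tendsto_finsetSum (Finset.range m)
      fun (j : ℕ) _ => (hshift ((j : ℤ) - m)).mul (hshift j)
    simpa [add_sub_assoc] using this
  simpa using h0.const_sub (∑ j ∈ Finset.range m, G j)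

theorem measure_Iio_zero_of_msuppZ_subset {μ : Measure ℤ} (hsupp : msuppZ μ ⊆ Ici 0) :
    μ (Iio 0) = 0 := by
  rw [measure_null_iff_singleton (Set.to_countable _)]
  intro k hk
  by_contra h
  exact (not_le.2 hk) (mem_Ici.1 (hsupp h))

theorem measure_Ioi_of_neg {μ : Measure ℤ} [IsProbabilityMeasure μ]
    (hsupp : msuppZ μ ⊆ Ici 0) {k : ℤ} (hk : k < 0) : μ (Ioi k) = 1 := by
  rw [prob_compl_eq_zero_iff (MeasurableSet.of_discrete) |>.symm]
  exact measure_mono_null (fun j hj => by simp at hj ⊢; omega)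
    (measure_Iio_zero_of_msuppZ_subset hsupp)

theorem tendsto_measure_Ioi_atTop (μ : Measure ℤ) [IsFiniteMeasure μ] :
    Filter.Tendsto (fun k : ℤ => μ (Ioi k)) Filter.atTop (nhds 0) := by
  have h := tendsto_measure_iInter_atTop (μ := μ) (s := fun k : ℤ => Ioi k)
    (fun _ => MeasurableSet.of_discrete.nullMeasurableSet)
    (fun _ _ h => Ioi_subset_Ioi h) ⟨0, measure_ne_top _ _⟩
  have h' : ⋂ k : ℤ, Ioi k = ∅ := by
    ext j
    simpa using ⟨j, le_rfl⟩
  simpa [h', Function.comp_def] using h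

theorem tsum_measure_Ioi_mul_measure_Ioc {μ : Measure ℤ} [IsProbabilityMeasure μ]
    (hsupp : msuppZ μ ⊆ Ici 0) (m : ℕ) :
    ∑' x : ℕ, μ (Ioi (x : ℤ)) * μ (Ioc ((x : ℤ) - m) ((x : ℤ) + m))
      = ∑ j ∈ Finset.range m, μ (Ioi (j : ℤ)) := by
  have h := hasSum_tail_mul_sub_tail (G := fun k => μ.real (Ioi k))
    (fun _ _ h => measureReal_mono (Ioi_subset_Ioi h))
    (by simpa [Measure.real, Function.comp_def] using
      (ENNReal.tendsto_toReal ENNReal.zero_ne_top).comp (tendsto_measure_Ioi_atTop μ))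
    (fun k hk => by simp [Measure.real, measure_Ioi_of_neg hsupp hk]) m
  have hIoc : ∀ x : ℕ, μ.real (Ioi ((x : ℤ) - m)) - μ.real (Ioi ((x : ℤ) + m))
      = μ.real (Ioc ((x : ℤ) - m) ((x : ℤ) + m)) := by
    intro x
    rw [← measureReal_sdiff (Ioi_subset_Ioi (by omega)) MeasurableSet.of_discrete]
    congr 1
    ext j
    simp
  simp only [hIoc] at h
  have h2 := ENNReal.ofReal_tsum_of_nonneg (fun x => by positivity) h.summable
  rw [h.tsum_eq, ENNReal.ofReal_sum_of_nonneg fun _ _ => by positivity] at h2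
  simpa [ENNReal.ofReal_mul, measureReal_nonneg] using h2.symm

theorem two_mul_boudibaMeasure_zero {μ : Measure ℤ} [IsProbabilityMeasure μ]
    (hsupp : msuppZ μ ⊆ Ici 0) : 2 * boudibaMeasure μ 0 = μ (Ioi 0) := by
  have h : μ {0} + μ (Ioi 0) = 1 := by
    rw [← measure_union (by simp) MeasurableSet.of_discrete,
      ← measure_Ioi_of_neg hsupp (neg_one_lt_zero)]
    congr 1
    ext j
    simp
    omega
  rw [boudibaMeasure, if_pos rfl, ENNReal.mul_div_cancel two_ne_zero ENNReal.ofNat_ne_top, ← h,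
    ENNReal.add_sub_cancel_left (measure_ne_top _ _)]

theorem two_mul_boudibaMeasure_succ (μ : Measure ℤ) (x : ℕ) :
    2 * boudibaMeasure μ (x + 1) = μ (Ioi (x : ℤ)) + μ (Ioi ((x + 1 : ℕ) : ℤ)) := by
  have h : μ (Ioi (x : ℤ)) = μ {((x + 1 : ℕ) : ℤ)} + μ (Ioi ((x + 1 : ℕ) : ℤ)) := by
    rw [← measure_union (by simp) MeasurableSet.of_discrete]
    congr 1
    ext j
    simp
  rw [boudibaMeasure, if_neg x.succ_ne_zero, mul_add,
    ENNReal.mul_div_cancel two_ne_zero ENNReal.ofNat_ne_top, h, two_mul, add_assoc]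

theorem two_mul_tsum_boudibaMeasure_mul {μ : Measure ℤ} [IsProbabilityMeasure μ]
    (hsupp : msuppZ μ ⊆ Ici 0) (g : ℕ → ℝ≥0∞) :
    2 * ∑' x, boudibaMeasure μ x * g x = ∑' x : ℕ, μ (Ioi (x : ℤ)) * (g x + g (x + 1)) := by
  simp only [← ENNReal.tsum_mul_left, ← mul_assoc]
  rw [tsum_eq_zero_add' ENNReal.summable, two_mul_boudibaMeasure_zero hsupp]
  simp only [two_mul_boudibaMeasure_succ, mul_add, add_mul]
  rw [ENNReal.tsum_add, ENNReal.tsum_add,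
    tsum_eq_zero_add' (f := fun x : ℕ => μ (Ioi (x : ℤ)) * g x) ENNReal.summable]
  simp only [Nat.cast_zero]
  ring

theorem measure_step_zero_add (μ : Measure ℤ) (x : ℕ) :
    μ {w : ℤ | ((x : ℤ) - w).natAbs = 0} + μ {w : ℤ | (((x + 1 : ℕ) : ℤ) - w).natAbs = 0}
      = μ (Ioc ((x : ℤ) - (1 : ℕ)) ((x : ℤ) + (1 : ℕ))) := by
  rw [← measure_union _ MeasurableSet.of_discrete]
  · congr 1
    ext w
    simp only [mem_union, mem_ofPred_eq, mem_Ioc]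
    omega
  · rw [Set.disjoint_left]
    intro w
    simp only [mem_ofPred_eq]
    omega

theorem measure_step_succ_add (μ : Measure ℤ) (x y : ℕ) :
    μ {w : ℤ | ((x : ℤ) - w).natAbs = y + 1}
        + μ {w : ℤ | (((x + 1 : ℕ) : ℤ) - w).natAbs = y + 1}
        + μ (Ioc ((x : ℤ) - y) ((x : ℤ) + y))
      = μ (Ioc ((x : ℤ) - (y + 2 : ℕ)) ((x : ℤ) + (y + 2 : ℕ))) := by
  rw [← measure_union _ MeasurableSet.of_discrete, ← measure_union _ MeasurableSet.of_discrete]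
  · congr 1
    ext w
    simp only [mem_union, mem_ofPred_eq, mem_Ioc]
    omega
  all_goals
    rw [Set.disjoint_left]
    intro w
    simp only [mem_union, mem_ofPred_eq, mem_Ioc]
    omega

/-- Let `μ` be a probability measure on `ℤ` with
`supp(μ) ⊆ ℕ₀`. Then `ν` with `ν(0) = (1-μ{0})/2`, `ν(x) = μ{x}/2 + μ((x,∞))`
is invariant for the reflected random walk on `ℕ₀`:
`∑_{x} ν(x) μ{w : |x - w| = y} = ν(y)` for every `y ∈ ℕ₀`. -/
theorem stmt_8 (μ : Measure ℤ) [IsProbabilityMeasure μ]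
    (hsupp : msuppZ μ ⊆ Ici 0) :
    ∀ y : ℕ, ∑' x : ℕ,
        boudibaMeasure μ x * μ {w : ℤ | ((x : ℤ) - w).natAbs = y}
      = boudibaMeasure μ y := by
  intro y
  rw [← ENNReal.mul_right_inj two_ne_zero ENNReal.ofNat_ne_top,
    two_mul_tsum_boudibaMeasure_mul hsupp]
  cases y with
  | zero =>
    simp only [measure_step_zero_add]
    rw [tsum_measure_Ioi_mul_measure_Ioc hsupp, two_mul_boudibaMeasure_zero hsupp]
    simp
  | succ y =>
    have h := tsum_measure_Ioi_mul_measure_Ioc hsupp (y + 2)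
    simp only [← measure_step_succ_add] at h
    simp only [mul_add _ (_ + _) (μ (Ioc _ _))] at h
    rw [ENNReal.tsum_add, tsum_measure_Ioi_mul_measure_Ioc hsupp, Finset.sum_range_succ,
      Finset.sum_range_succ, add_assoc, add_comm] at h
    rw [two_mul_boudibaMeasure_succ]
    exact (ENNReal.add_right_inj (ENNReal.sum_ne_top.2 fun _ _ => measure_ne_top _ _)).1 h

end
end

section
/- Let μ be a probability measure on ℝ with supp(μ) ⊆ [0,∞). If ∫ √y dμ(y) < ∞, then ∫₀^∞ μ((x,∞))² dx < ∞. -/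
open MeasureTheory Set
open scoped ENNReal

noncomputable section

/-- Markov's inequality for the square root, in division-free form. -/
theorem meas_Ioi_le_lintegral_sqrt_mul (μ : Measure ℝ) {x : ℝ} (hx : 0 < x) :
    μ (Ioi x) ≤
      (∫⁻ y, ENNReal.ofReal (Real.sqrt y) ∂μ) * ENNReal.ofReal (x ^ ((1 : ℝ) / 2 - 1)) := by
  have hsqrt : 0 < Real.sqrt x := Real.sqrt_pos.2 hx
  have hpow : x ^ ((1 : ℝ) / 2 - 1) = (Real.sqrt x)⁻¹ := by
    rw [Real.sqrt_eq_rpow, ← Real.rpow_neg hx.le]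
    norm_num
  rw [hpow, ENNReal.ofReal_inv_of_pos hsqrt, ← div_eq_mul_inv]
  refine (measure_mono fun y (hy : x < y) ↦ ?_).trans
    (meas_ge_le_lintegral_div (f := fun y ↦ ENNReal.ofReal (Real.sqrt y)) (by fun_prop)
      (ENNReal.ofReal_pos.2 hsqrt).ne' ENNReal.ofReal_ne_top)
  exact ENNReal.ofReal_le_ofReal (Real.sqrt_le_sqrt hy.le)

/-- The layer cake formula for the square root. -/
theorem lintegral_sqrt_eq_lintegral_meas_Ioi_mul (μ : Measure ℝ) :
    ∫⁻ y, ENNReal.ofReal (Real.sqrt y) ∂μ = ENNReal.ofReal (1 / 2) *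
      ∫⁻ x in Ioi 0, μ (Ioi x) * ENNReal.ofReal (x ^ ((1 : ℝ) / 2 - 1)) := by
  have h := lintegral_rpow_eq_lintegral_meas_lt_mul μ (f := fun y : ℝ ↦ max y 0)
    (ae_of_all _ fun y ↦ le_max_right y 0) (by fun_prop) (p := 1 / 2) (by norm_num)
  have hsqrt (y : ℝ) : (max y 0) ^ ((1 : ℝ) / 2) = Real.sqrt y := by
    rw [← Real.sqrt_eq_rpow]
    rcases le_total y 0 with hy | hy
    · rw [max_eq_right hy, Real.sqrt_zero, Real.sqrt_eq_zero_of_nonpos hy]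
    · rw [max_eq_left hy]
  simp only [hsqrt] at h
  rw [h]
  congr 1
  refine setLIntegral_congr_fun measurableSet_Ioi fun x (hx : 0 < x) ↦ ?_
  have hset : {y : ℝ | x < max y 0} = Ioi x := by
    ext y
    simp [hx.not_gt]
  simp only [hset]

/-- Let `μ` be a probability measure on `ℝ` with
`supp(μ) ⊆ [0,∞)`. If `∫ √y dμ(y) < ∞`, then `∫₀^∞ μ((x,∞))² dx < ∞`. -/
theorem stmt_10 (μ : Measure ℝ) [IsProbabilityMeasure μ]
    (hsupp : msupp μ ⊆ Ici 0)
    (hmom : ∫⁻ y, ENNReal.ofReal (Real.sqrt y) ∂μ < ∞) :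
    ∫⁻ x in Ici (0 : ℝ), (μ (Ioi x)) ^ 2 ∂volume < ∞ := by
  set C := ∫⁻ y, ENNReal.ofReal (Real.sqrt y) ∂μ
  have hfin : ∫⁻ x in Ioi 0, μ (Ioi x) * ENNReal.ofReal (x ^ ((1 : ℝ) / 2 - 1)) ≠ ∞ := by
    intro htop
    have h := lintegral_sqrt_eq_lintegral_meas_Ioi_mul μ
    rw [htop, ENNReal.mul_top (ENNReal.ofReal_pos.2 (by norm_num)).ne'] at h
    exact hmom.ne h
  rw [setLIntegral_congr Ioi_ae_eq_Ici.symm]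
  calc ∫⁻ x in Ioi (0 : ℝ), (μ (Ioi x)) ^ 2
      ≤ ∫⁻ x in Ioi (0 : ℝ), C * (μ (Ioi x) * ENNReal.ofReal (x ^ ((1 : ℝ) / 2 - 1))) := by
        refine setLIntegral_mono' measurableSet_Ioi fun x (hx : 0 < x) ↦ ?_
        rw [sq, mul_left_comm]
        gcongr
        exact meas_Ioi_le_lintegral_sqrt_mul μ hx
    _ = C * ∫⁻ x in Ioi (0 : ℝ), μ (Ioi x) * ENNReal.ofReal (x ^ ((1 : ℝ) / 2 - 1)) :=
        lintegral_const_mul' _ _ hmom.ne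
    _ < ∞ := ENNReal.mul_lt_top hmom hfin.lt_top

end
end

section
/- Let μ be a probability measure on ℝ with supp(μ) ⊆ [0,∞). If ∫₀^∞ μ((x,∞))² dx < ∞, then lim_{y → ∞} μ((y,∞)) · ∫₀^y μ((x, y]) dx = 0. -/
open MeasureTheory Set Filter
open scoped ENNReal

noncomputable section

theorem tendsto_measure_Ioi_atTop_zero (μ : Measure ℝ) [IsFiniteMeasure μ] :
    Tendsto (fun y : ℝ => μ (Ioi y)) atTop (nhds 0) := by
  have h := tendsto_measure_iInter_atTop (μ := μ) (s := fun y : ℝ => Ioi y)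
    (fun _ => measurableSet_Ioi.nullMeasurableSet) (fun _ _ hab => Ioi_subset_Ioi hab)
    ⟨0, measure_ne_top μ _⟩
  have h_empty : ⋂ y : ℝ, Ioi y = ∅ :=
    eq_empty_of_forall_notMem fun x hx => lt_irrefl x (mem_iInter.1 hx x)
  rwa [h_empty, measure_empty] at h

/-- Let `μ` be a probability measure on `ℝ` with
`supp(μ) ⊆ [0,∞)`. If `∫₀^∞ μ((x,∞))² dx < ∞`, then
`lim_{y → ∞} μ((y,∞)) · ∫₀^y μ((x,y]) dx = 0`. -/
theorem stmt_11 (μ : Measure ℝ) [IsProbabilityMeasure μ]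
    (hsupp : msupp μ ⊆ Ici 0)
    (hsq : ∫⁻ x in Ici (0 : ℝ), (μ (Ioi x)) ^ 2 ∂volume < ∞) :
    Tendsto (fun y : ℝ => μ (Ioi y) * ∫⁻ x in Icc (0 : ℝ) y, μ (Ioc x y) ∂volume)
      atTop (nhds 0) := by
  have h_anti : Antitone fun x : ℝ => μ (Ioi x) :=
    fun _ _ hab => measure_mono (Ioi_subset_Ioi hab)
  have h_meas : Measurable fun x : ℝ => μ (Ioi x) := h_anti.measurable
  have h_tail := tendsto_measure_Ioi_atTop_zero μ
  have h_lim : Tendsto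
      (fun y : ℝ => ∫⁻ x in Ici (0 : ℝ), min (μ (Ioi y)) (μ (Ioi x)) * μ (Ioi x))
      atTop (nhds (∫⁻ _ in Ici (0 : ℝ), 0)) := by
    refine tendsto_lintegral_filter_of_dominated_convergence (fun x => μ (Ioi x) ^ 2)
      (Eventually.of_forall fun y => (measurable_const.min h_meas).mul h_meas)
      (Eventually.of_forall fun y => Eventually.of_forall fun x => ?_) hsq.ne
      (Eventually.of_forall fun x => ?_)
    · rw [sq]
      gcongr
      exact min_le_right _ _
    · have h_mul := ENNReal.Tendsto.mul_const (b := μ (Ioi x)) h_tail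
        (Or.inr (measure_ne_top μ _))
      rw [zero_mul] at h_mul
      refine tendsto_of_tendsto_of_tendsto_of_le_of_le tendsto_const_nhds h_mul
        (fun _ => zero_le) fun y => ?_
      dsimp only
      gcongr
      exact min_le_left _ _
  rw [lintegral_zero] at h_lim
  refine tendsto_of_tendsto_of_tendsto_of_le_of_le tendsto_const_nhds h_lim
    (fun _ => zero_le) fun y => ?_
  calc μ (Ioi y) * ∫⁻ x in Icc (0 : ℝ) y, μ (Ioc x y)
      ≤ μ (Ioi y) * ∫⁻ x in Icc (0 : ℝ) y, μ (Ioi x) := by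
        gcongr with x
        exact Ioc_subset_Ioi_self
    _ = ∫⁻ x in Icc (0 : ℝ) y, μ (Ioi y) * μ (Ioi x) :=
        (lintegral_const_mul _ h_meas).symm
    _ = ∫⁻ x in Icc (0 : ℝ) y, min (μ (Ioi y)) (μ (Ioi x)) * μ (Ioi x) :=
        setLIntegral_congr_fun measurableSet_Icc fun x hx => by
          simp only [min_eq_left (h_anti hx.2)]
    _ ≤ ∫⁻ x in Ici (0 : ℝ), min (μ (Ioi y)) (μ (Ioi x)) * μ (Ioi x) :=
        lintegral_mono_set Icc_subset_Ici_self

end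
end
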